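/- Let p > 1 and T > 0. Then λ^+_p(-T,T) = inf{∫_{-T}^T ((u'(t))^+)^p dt : u ∈ W_{pw}^{1,p,+}(-T,T), ∫_{-T}^T |u(t)|^p dt = 1}; that is, enlarging the admissible class from W^{1,p}_0(-T,T) to the piecewise Sobolev class W_{pw}^{1,p,+}(-T,T) does not change the infimum. -/

import Mathlib

open MeasureTheory Filter Set
open scoped Topology RealInnerProductSpace

noncomputable section

/-- Positive part. -/
def ppart (t : ℝ) : ℝ := max t 0
/-- Negative part. -/
def npart (t : ℝ) : ℝ := max (-t) 0

/-- `u ∈ W^{1,p}(α,β)` (continuous representative on `[α,β]`), with weak derivative `u'`. -/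
def MemW1pC (p α β : ℝ) (u u' : ℝ → ℝ) : Prop :=
  IntervalIntegrable u' volume α β ∧
  (∀ t ∈ Set.Icc α β, u t = u α + ∫ s in α..t, u' s) ∧
  IntegrableOn (fun t => |u' t| ^ p) (Set.Ioo α β) volume

/-- `u ∈ W^{1,p}_0(α,β)`, with weak derivative `u'`. -/
def MemW1p0 (p α β : ℝ) (u u' : ℝ → ℝ) : Prop :=
  MemW1pC p α β u u' ∧ u α = 0 ∧ u β = 0

/-- `u ∈ W^{1,p}(α,β)` (interior version: no constraint at endpoints). -/
def MemW1pI (p α β : ℝ) (u u' : ℝ → ℝ) : Prop :=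
  IntervalIntegrable u' volume α β ∧
  (∀ s ∈ Set.Ioo α β, ∀ t ∈ Set.Ioo α β, u t = u s + ∫ r in s..t, u' r) ∧
  IntegrableOn (fun t => |u' t| ^ p) (Set.Ioo α β) volume

/-- `λ_p^H(α,β)` for a one-dimensional anisotropy `H`. -/
def lamH1 (p : ℝ) (H : ℝ → ℝ) (α β : ℝ) : ℝ :=
  sInf { E | ∃ u u', MemW1p0 p α β u u' ∧ (∫ t in Set.Ioo α β, |u t| ^ p) = 1 ∧
    E = ∫ t in Set.Ioo α β, H (u' t) ^ p }

/-- `λ_{1,p}(α,β)`, the principal Dirichlet eigenvalue of the 1d `p`-Laplacian. -/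
def lam1 (p α β : ℝ) : ℝ := lamH1 p (fun t => |t|) α β

/-- `λ_p^{a,b}(α,β)`. -/
def lamAB (p a b α β : ℝ) : ℝ := lamH1 p (fun t => a * ppart t + b * npart t) α β

/-- `λ_p^+(-T,T)`. -/
def lamPlus (p T : ℝ) : ℝ := lamH1 p ppart (-T) T

/-- `φ` is the (normalized positive) principal eigenfunction of the 1d `p`-Laplacian
on `(-T,T)`, with weak derivative `φ'`. -/
def IsPrincipalEigenfunction (p T : ℝ) (φ φ' : ℝ → ℝ) : Prop :=
  MemW1p0 p (-T) T φ φ' ∧ (∀ t ∈ Set.Ioo (-T) T, 0 < φ t) ∧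
  (∫ t in Set.Ioo (-T) T, |φ t| ^ p) = 1 ∧
  (∫ t in Set.Ioo (-T) T, |φ' t| ^ p) = lam1 p (-T) T

/-- The piecewise Sobolev class `W_pw^{1,p,+}(-T,T)`. -/
def MemWpw (p T : ℝ) (u u' : ℝ → ℝ) : Prop :=
  ∃ (m : ℕ) (P : ℕ → ℝ), 0 < m ∧ P 0 = -T ∧ P m = T ∧
    (∀ i < m, P i < P (i + 1)) ∧
    (∀ i < m, MemW1pI p (P i) (P (i + 1)) u u') ∧
    (∃ l₀, Tendsto u (𝓝[>] (-T)) (𝓝 l₀) ∧ l₀ ≤ 0) ∧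
    (∃ l₁, Tendsto u (𝓝[<] T) (𝓝 l₁) ∧ 0 ≤ l₁) ∧
    (∀ i, 0 < i → i < m → ∃ lm lp, Tendsto u (𝓝[<] (P i)) (𝓝 lm) ∧
      Tendsto u (𝓝[>] (P i)) (𝓝 lp) ∧ lp < lm)

/-! ### Two dimensions -/

/-- The Euclidean plane. -/
abbrev V2 := EuclideanSpace ℝ (Fin 2)

/-- The point of `ℝ²` with coordinates `(x, y)`. -/
def mk2 (x y : ℝ) : V2 := (EuclideanSpace.equiv (Fin 2) ℝ).symm ![x, y]

/-- An asymmetric anisotropy: nonnegative, convex and positively 1-homogeneous. -/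
def IsAnisotropy (H : V2 → ℝ) : Prop :=
  (∀ v, 0 ≤ H v) ∧ ConvexOn ℝ Set.univ H ∧ ∀ t : ℝ, 0 < t → ∀ v : V2, H (t • v) = t * H v

/-- A bounded domain of `ℝ²`. -/
def IsBoundedDomain (Ω : Set V2) : Prop :=
  IsOpen Ω ∧ IsConnected Ω ∧ Bornology.IsBounded Ω

/-- Smooth compactly supported test function on `Ω`. -/
def TestFun2 (Ω : Set V2) (φ : V2 → ℝ) : Prop :=
  ContDiff ℝ (⊤ : ℕ∞) φ ∧ HasCompactSupport φ ∧ tsupport φ ⊆ Ω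

/-- `u ∈ W^{1,p}_0(Ω)`, with weak gradient `g`: `u` and `g` are `p`-integrable on `Ω`
and approximable in `W^{1,p}`-norm by smooth functions compactly supported in `Ω`. -/
def MemW1p02 (p : ℝ) (Ω : Set V2) (u : V2 → ℝ) (g : V2 → V2) : Prop :=
  IntegrableOn (fun x => |u x| ^ p) Ω volume ∧
  IntegrableOn (fun x => ‖g x‖ ^ p) Ω volume ∧
  ∃ φ : ℕ → V2 → ℝ, (∀ n, TestFun2 Ω (φ n)) ∧
    Tendsto (fun n => ∫ x in Ω, |u x - φ n x| ^ p) atTop (𝓝 0) ∧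
    Tendsto (fun n => ∫ x in Ω, ‖g x - gradient (φ n) x‖ ^ p) atTop (𝓝 0)

/-- The least anisotropic energy level `λ_p^H(Ω)`. -/
def lamH (p : ℝ) (H : V2 → ℝ) (Ω : Set V2) : ℝ :=
  sInf { E | ∃ u g, MemW1p02 p Ω u g ∧ (∫ x in Ω, |u x| ^ p) = 1 ∧
    E = ∫ x in Ω, H (g x) ^ p }

/-- `λ_p^H(Ω)` is a fundamental frequency of `-Δ_p^H` on `Ω`. -/
def IsFundFreq (p : ℝ) (H : V2 → ℝ) (Ω : Set V2) : Prop :=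
  ∃ u g, MemW1p02 p Ω u g ∧ ¬ (∀ᵐ x ∂(volume.restrict Ω), u x = 0) ∧
    (∀ᵐ x ∂(volume.restrict Ω), DifferentiableAt ℝ H (g x)) ∧
    AEMeasurable (fun x => gradient H (g x)) (volume.restrict Ω) ∧
    ∀ φ gφ, MemW1p02 p Ω φ gφ →
      (∫ x in Ω, H (g x) ^ (p - 1) * ⟪gradient H (g x), gφ x⟫) =
        lamH p H Ω * ∫ x in Ω, |u x| ^ (p - 2) * u x * φ x

/-- The infimum `λ_p^H(Ω)` is attained by a (normalized, hence nonzero) function. -/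
def IsAttained (p : ℝ) (H : V2 → ℝ) (Ω : Set V2) : Prop :=
  ∃ u g, MemW1p02 p Ω u g ∧ (∫ x in Ω, |u x| ^ p) = 1 ∧
    (∫ x in Ω, H (g x) ^ p) = lamH p H Ω

/-- `‖H‖ := max {H v : |v| = 1}`. -/
def normH (H : V2 → ℝ) : ℝ := sSup (H '' Metric.sphere 0 1)

/-- A rotation: a linear isometry with positive determinant. -/
def IsRotation (A : V2 ≃ₗᵢ[ℝ] V2) : Prop :=
  0 < LinearMap.det (A.toLinearEquiv : V2 →ₗ[ℝ] V2)

/-- The kernel of an anisotropy. -/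
def kerH (H : V2 → ℝ) : Set V2 := {v | H v = 0}

/-- `S` is a line through the origin. -/
def IsLine (S : Set V2) : Prop := ∃ v : V2, v ≠ 0 ∧ S = {w | ∃ t : ℝ, w = t • v}

/-- `S` is a closed half-plane bounded by a line through the origin. -/
def IsClosedHalfPlane (S : Set V2) : Prop := ∃ v : V2, v ≠ 0 ∧ S = {w | ⟪v, w⟫ ≤ 0}

/-- Smooth compactly supported test function on an open set `S ⊆ ℝ`. -/
def TestFun1 (S : Set ℝ) (φ : ℝ → ℝ) : Prop :=
  ContDiff ℝ (⊤ : ℕ∞) φ ∧ HasCompactSupport φ ∧ tsupport φ ⊆ S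

/-- `v ∈ W^{1,p}_0(S)` for an open set `S ⊆ ℝ`, with weak derivative `v'`. -/
def MemW1p0S (p : ℝ) (S : Set ℝ) (v v' : ℝ → ℝ) : Prop :=
  IntegrableOn (fun t => |v t| ^ p) S volume ∧
  IntegrableOn (fun t => |v' t| ^ p) S volume ∧
  ∃ φ : ℕ → ℝ → ℝ, (∀ n, TestFun1 S (φ n)) ∧
    Tendsto (fun n => ∫ t in S, |v t - φ n t| ^ p) atTop (𝓝 0) ∧
    Tendsto (fun n => ∫ t in S, |v' t - deriv (φ n) t| ^ p) atTop (𝓝 0)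

/-- A bounded domain with Lipschitz (`C^{0,1}`) boundary: near each boundary point, after a
rigid motion, `Ω` is the region above the graph of a Lipschitz function. -/
def IsC01Domain (Ω : Set V2) : Prop :=
  IsBoundedDomain Ω ∧
  ∀ z ∈ frontier Ω, ∃ (A : V2 ≃ₗᵢ[ℝ] V2) (r K : ℝ) (f : ℝ → ℝ), 0 < r ∧ 0 ≤ K ∧
    LipschitzWith (Real.toNNReal K) f ∧
    ∀ v ∈ Metric.ball z r, (v ∈ Ω ↔ f ((A (v - z)) 0) < (A (v - z)) 1)

/-- The supremal length of a vertical open segment contained in `D`. -/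
def vertWidth (D : Set V2) : ℝ :=
  sSup {l : ℝ | ∃ x c : ℝ, ∀ y ∈ Set.Ioo c (c + l), mk2 x y ∈ D}

/-- The width function `L_θ` of `Ω` in direction `θ`. -/
def widthFn (Ω : Set V2) (θ : ℝ) : ℝ :=
  sSup {l : ℝ | ∃ (v : V2) (t0 : ℝ),
    ∀ t ∈ Set.Ioo t0 (t0 + l), v + t • mk2 (Real.cos θ) (Real.sin θ) ∈ Ω}

/-- The variational `p`-capacity of `K` relative to `B`. -/
def pCap (p : ℝ) (K B : Set V2) : ℝ :=
  sInf { E | ∃ φ : V2 → ℝ, ContDiff ℝ (⊤ : ℕ∞) φ ∧ HasCompactSupport φ ∧ tsupport φ ⊆ B ∧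
    (∀ x ∈ K, 1 ≤ φ x) ∧ E = ∫ x, ‖gradient φ x‖ ^ p }

/-- The Wiener criterion for the `p`-Laplacian at a boundary point `z`:
the Wiener integral diverges. -/
def WienerRegularAt (p : ℝ) (Ω : Set V2) (z : V2) : Prop :=
  ¬ IntegrableOn (fun t =>
      (pCap p (Metric.closedBall z t \ Ω) (Metric.ball z (2 * t)) /
        pCap p (Metric.closedBall z t) (Metric.ball z (2 * t))) ^ (1 / (p - 1)) / t)
    (Set.Ioo (0 : ℝ) 1) volume

/-- The optimal lower spectral constant `Λ^min(Ω)`. -/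
def LambdaMin (p : ℝ) (Ω : Set V2) : ℝ :=
  sInf {lam : ℝ | ∃ H : V2 → ℝ, IsAnisotropy H ∧ normH H = 1 ∧ IsFundFreq p H Ω ∧
    lam = lamH p H Ω}

end

noncomputable section

lemma ppart_nonneg (t : ℝ) : 0 ≤ ppart t := le_max_right _ _

lemma le_ppart (t : ℝ) : t ≤ ppart t := le_max_left _ _

lemma ppart_le_abs (t : ℝ) : ppart t ≤ |t| := max_le (le_abs_self t) (abs_nonneg t)

lemma ppart_mul_of_nonneg {c : ℝ} (hc : 0 ≤ c) (t : ℝ) : ppart (c * t) = c * ppart t := by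
  simp [ppart, mul_max_of_nonneg _ _ hc]

lemma continuous_ppart : Continuous ppart := continuous_id.max continuous_const

lemma integral_ppart_rpow_nonneg (p : ℝ) (u : ℝ → ℝ) (s : Set ℝ) :
    0 ≤ ∫ t in s, ppart (u t) ^ p :=
  integral_nonneg fun _ => Real.rpow_nonneg (ppart_nonneg _) p

lemma MemW1p0.const_mul {p α β c : ℝ} {u u' : ℝ → ℝ} (hc : 0 ≤ c) (h : MemW1p0 p α β u u') :
    MemW1p0 p α β (fun t => c * u t) (fun t => c * u' t) := by
  obtain ⟨⟨h1, h2, h3⟩, h4, h5⟩ := h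
  refine ⟨⟨h1.const_mul c, fun t ht => ?_, ?_⟩, by simp [h4], by simp [h5]⟩
  · simp only [intervalIntegral.integral_const_mul]
    rw [h2 t ht]
    ring
  · have : (fun t => |c * u' t| ^ p) = fun t => c ^ p * |u' t| ^ p := by
      funext t
      rw [abs_mul, abs_of_nonneg hc, Real.mul_rpow hc (abs_nonneg _)]
    rw [this]
    exact h3.const_mul _

/-- Normalizing a nonzero element of `W^{1,p}_0`. -/
lemma MemW1p0.exists_normalized {p α β : ℝ} {v v' : ℝ → ℝ} (hp : 0 < p)
    (h : MemW1p0 p α β v v') (hK : 0 < ∫ t in Ioo α β, |v t| ^ p) :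
    ∃ u u', MemW1p0 p α β u u' ∧ (∫ t in Ioo α β, |u t| ^ p) = 1 ∧
      (∫ t in Ioo α β, ppart (u' t) ^ p) =
        (∫ t in Ioo α β, |v t| ^ p)⁻¹ * ∫ t in Ioo α β, ppart (v' t) ^ p := by
  set K := ∫ t in Ioo α β, |v t| ^ p
  have hKi : 0 < K⁻¹ := inv_pos.2 hK
  have hc : 0 ≤ K⁻¹ ^ p⁻¹ := Real.rpow_nonneg hKi.le _
  have hcp : (K⁻¹ ^ p⁻¹) ^ p = K⁻¹ := by
    rw [← Real.rpow_mul hKi.le, inv_mul_cancel₀ hp.ne', Real.rpow_one]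
  refine ⟨_, _, h.const_mul hc, ?_, ?_⟩
  · have : ∀ t, |K⁻¹ ^ p⁻¹ * v t| ^ p = K⁻¹ * |v t| ^ p := fun t => by
      rw [abs_mul, abs_of_nonneg hc, Real.mul_rpow hc (abs_nonneg _), hcp]
    simp only [this, integral_const_mul]
    exact inv_mul_cancel₀ hK.ne'
  · have : ∀ t, ppart (K⁻¹ ^ p⁻¹ * v' t) ^ p = K⁻¹ * ppart (v' t) ^ p := fun t => by
      rw [ppart_mul_of_nonneg hc, Real.mul_rpow hc (ppart_nonneg _), hcp]
    simp only [this, integral_const_mul]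

lemma lamPlus_le_inv_mul {p T : ℝ} {v v' : ℝ → ℝ} (hp : 0 < p) (h : MemW1p0 p (-T) T v v')
    (hK : 0 < ∫ t in Ioo (-T) T, |v t| ^ p) :
    lamPlus p T ≤
      (∫ t in Ioo (-T) T, |v t| ^ p)⁻¹ * ∫ t in Ioo (-T) T, ppart (v' t) ^ p := by
  obtain ⟨u, u', hu, h1, h2⟩ := h.exists_normalized hp hK
  rw [← h2]
  refine csInf_le ⟨0, ?_⟩ ⟨u, u', hu, h1, rfl⟩
  rintro E ⟨u, u', -, -, rfl⟩
  exact integral_ppart_rpow_nonneg p u' _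

lemma exists_memW1p0_normalized {p T : ℝ} (hp : 0 < p) (hT : 0 < T) :
    ∃ u u', MemW1p0 p (-T) T u u' ∧ (∫ t in Ioo (-T) T, |u t| ^ p) = 1 := by
  have hcont : Continuous fun t : ℝ => |T ^ 2 - t ^ 2| ^ p :=
    (by fun_prop : Continuous fun t : ℝ => |T ^ 2 - t ^ 2|).rpow_const fun _ => Or.inr hp.le
  have hcont' : Continuous fun t : ℝ => |-(2 * t)| ^ p :=
    (by fun_prop : Continuous fun t : ℝ => |-(2 * t)|).rpow_const fun _ => Or.inr hp.le
  have hmem : MemW1p0 p (-T) T (fun t => T ^ 2 - t ^ 2) (fun t => -(2 * t)) := by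
    refine ⟨⟨(by fun_prop : Continuous fun t : ℝ => -(2 * t)).intervalIntegrable _ _,
      fun t _ => ?_, ?_⟩, by ring, by ring⟩
    · rw [intervalIntegral.integral_neg, intervalIntegral.integral_const_mul, integral_id]
      ring
    · exact (hcont'.integrableOn_Icc).mono_set Ioo_subset_Icc_self
  have hpos : 0 < ∫ t in Ioo (-T) T, |T ^ 2 - t ^ 2| ^ p := by
    rw [← integral_Ioc_eq_integral_Ioo, ← intervalIntegral.integral_of_le (by linarith)]
    refine intervalIntegral.intervalIntegral_pos_of_pos_on (hcont.intervalIntegrable _ _) ?_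
      (by linarith)
    intro t ht
    refine Real.rpow_pos_of_pos (abs_pos.2 ?_) p
    nlinarith [ht.1, ht.2]
  obtain ⟨u, u', hu, h1, -⟩ := hmem.exists_normalized hp hpos
  exact ⟨u, u', hu, h1⟩

lemma MemW1p0.memWpw {p T : ℝ} {u u' : ℝ → ℝ} (hT : 0 < T) (h : MemW1p0 p (-T) T u u') :
    MemWpw p T u u' := by
  obtain ⟨⟨h1, h2, h3⟩, h4, h5⟩ := h
  have hle : -T ≤ T := by linarith
  have hcont : ContinuousOn u (Icc (-T) T) := by
    have := (intervalIntegral.continuousOn_primitive_interval' h1 left_mem_uIcc).const_add (u (-T))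
    rw [uIcc_of_le hle] at this
    exact this.congr h2
  have hsub : ∀ {s t}, s ∈ Icc (-T) T → t ∈ Icc (-T) T → IntervalIntegrable u' volume s t := by
    intro s t hs ht
    refine h1.mono_set (uIcc_subset_uIcc ?_ ?_) <;> rwa [uIcc_of_le hle]
  have hl : -T ∈ Icc (-T) T := left_mem_Icc.2 hle
  have hr : T ∈ Icc (-T) T := right_mem_Icc.2 hle
  refine ⟨1, fun i => if i = 0 then -T else T, one_pos, by simp, by simp, ?_, ?_, ?_, ?_, ?_⟩
  · intro i hi
    obtain rfl : i = 0 := by omega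
    simp [hT]
  · intro i hi
    obtain rfl : i = 0 := by omega
    simp only [if_true, zero_add, one_ne_zero, if_false]
    refine ⟨h1, fun s hs t ht => ?_, h3⟩
    have hs := Ioo_subset_Icc_self hs
    have ht := Ioo_subset_Icc_self ht
    rw [h2 s hs, h2 t ht, add_assoc,
      intervalIntegral.integral_add_adjacent_intervals (hsub hl hs) (hsub hs ht)]
  · refine ⟨u (-T), ?_, h4.le⟩
    exact ((hcont _ hl).mono Ioo_subset_Icc_self).tendsto.mono_left
      (nhdsWithin_Ioo_eq_nhdsGT (by linarith : -T < T)).ge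
  · refine ⟨u T, ?_, h5.ge⟩
    exact ((hcont _ hr).mono Ioo_subset_Icc_self).tendsto.mono_left
      (nhdsWithin_Ioo_eq_nhdsLT (by linarith : -T < T)).ge
  · intro i h0 hi
    omega

/-- An antitone function which is constant outside `(-T, T)` is the limit, at its continuity
points, of antitone Lipschitz functions with the same values at `± T`. -/
lemma Antitone.exists_lipschitz_approx {g : ℝ → ℝ} {M T : ℝ} (hT : 0 < T) (hg : Antitone g)
    (hl : ∀ t ≤ -T, g t = 0) (hr : ∀ t, T ≤ t → g t = -M) :
    ∃ G : ℕ → ℝ → ℝ, (∀ n, ∃ K, LipschitzWith K (G n)) ∧ (∀ n, Antitone (G n)) ∧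
      (∀ n, G n (-T) = 0) ∧ (∀ n, G n T = -M) ∧
      ∀ t, ContinuousAt g t → Tendsto (fun n => G n t) atTop (𝓝 (g t)) := by
  have hgi : ∀ a b, IntervalIntegrable g volume a b := fun a b => hg.intervalIntegrable
  have hgM : ∀ t, |g t| ≤ M := by
    intro t
    have h1 : g t ≤ 0 := by
      rw [← hl (min t (-T)) (min_le_right _ _)]
      exact hg (min_le_left _ _)
    have h2 : -M ≤ g t := by
      rw [← hr (max t T) (le_max_right _ _)]
      exact hg (le_max_left _ _)
    rw [abs_of_nonpos h1]
    linarith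
  have hM : 0 ≤ M := (abs_nonneg _).trans (hgM 0)
  set δ : ℕ → ℝ := fun n => 1 / ((n : ℝ) + 1) with hδdef
  have hδ : ∀ n, 0 < δ n := fun n => Nat.one_div_pos_of_nat
  have hδlim : Tendsto δ atTop (𝓝 0) := tendsto_one_div_add_atTop_nhds_zero_nat
  set φ : ℕ → ℝ → ℝ := fun n t => t - δ n * ((T - t) / (2 * T)) with hφdef
  have hφmono : ∀ n, Monotone (φ n) := by
    intro n s t hst
    have : (T - t) / (2 * T) ≤ (T - s) / (2 * T) := by gcongr
    have := mul_le_mul_of_nonneg_left this (hδ n).le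
    simp only [hφdef]
    linarith
  have hφl : ∀ n, φ n (-T) = -T - δ n := by
    intro n
    simp only [hφdef]
    field_simp
    ring
  have hφr : ∀ n, φ n T = T := by
    intro n
    simp [hφdef]
  have hφlim : ∀ t, Tendsto (fun n => φ n t) atTop (𝓝 t) := by
    intro t
    simpa using (tendsto_const_nhds (x := t)).sub (hδlim.mul_const ((T - t) / (2 * T)))
  have hgc : ∀ x a b, IntervalIntegrable (fun s => g (x + s)) volume a b := by
    intro x a b
    refine Antitone.intervalIntegrable fun s t hst => hg ?_
    gcongr
  have hlow : ∀ n t, g (φ n t + δ n) ≤ (δ n)⁻¹ * ∫ s in (0 : ℝ)..δ n, g (φ n t + s) := by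
    intro n t
    have : ∫ s in (0 : ℝ)..δ n, g (φ n t + δ n) ≤ ∫ s in (0 : ℝ)..δ n, g (φ n t + s) := by
      refine intervalIntegral.integral_mono_on (hδ n).le (by simp) (hgc _ _ _) fun s hs => hg ?_
      have := hs.2
      gcongr
    rw [intervalIntegral.integral_const, sub_zero, smul_eq_mul] at this
    rw [inv_mul_eq_div, le_div_iff₀' (hδ n)]
    exact this
  have hupp : ∀ n t, (δ n)⁻¹ * ∫ s in (0 : ℝ)..δ n, g (φ n t + s) ≤ g (φ n t) := by
    intro n t
    have : ∫ s in (0 : ℝ)..δ n, g (φ n t + s) ≤ ∫ s in (0 : ℝ)..δ n, g (φ n t) := by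
      refine intervalIntegral.integral_mono_on (hδ n).le (hgc _ _ _) (by simp) fun s hs => hg ?_
      linarith [hs.1]
    rw [intervalIntegral.integral_const, sub_zero, smul_eq_mul] at this
    rw [inv_mul_eq_div, div_le_iff₀' (hδ n)]
    exact this
  refine ⟨fun n t => (δ n)⁻¹ * ∫ s in (0 : ℝ)..δ n, g (φ n t + s), ?_, ?_, ?_, ?_, ?_⟩
  · intro n
    have hC : 0 ≤ (δ n)⁻¹ * (2 * M * (1 + δ n / (2 * T))) := by
      have := hδ n
      positivity
    refine ⟨Real.toNNReal ((δ n)⁻¹ * (2 * M * (1 + δ n / (2 * T)))),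
      LipschitzWith.of_dist_le_mul fun s t => ?_⟩
    rw [Real.coe_toNNReal _ hC]
    simp only [Real.dist_eq, intervalIntegral.integral_comp_add_left, add_zero]
    rw [← mul_sub, abs_mul, abs_of_pos (inv_pos.2 (hδ n)), mul_assoc]
    refine mul_le_mul_of_nonneg_left ?_ (inv_pos.2 (hδ n)).le
    rw [intervalIntegral.integral_interval_sub_interval_comm (hgi _ _) (hgi _ _) (hgi _ _)]
    have b1 : |∫ x in φ n s..φ n t, g x| ≤ M * |φ n t - φ n s| := by
      rw [← Real.norm_eq_abs]
      exact intervalIntegral.norm_integral_le_of_norm_le_const fun x _ => hgM x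
    have b2 : |∫ x in φ n s + δ n..φ n t + δ n, g x| ≤ M * |φ n t + δ n - (φ n s + δ n)| := by
      rw [← Real.norm_eq_abs]
      exact intervalIntegral.norm_integral_le_of_norm_le_const fun x _ => hgM x
    rw [add_sub_add_right_eq_sub] at b2
    have e : |φ n t - φ n s| = (1 + δ n / (2 * T)) * |s - t| := by
      have hpos : 0 ≤ 1 + δ n / (2 * T) := by
        have := hδ n
        positivity
      rw [abs_sub_comm s t, ← abs_of_nonneg hpos, ← abs_mul]
      congr 1
      simp only [hφdef]
      field_simp
      ring
    rw [e] at b1 b2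
    refine (abs_sub _ _).trans ?_
    linarith
  · intro n s t hst
    refine mul_le_mul_of_nonneg_left ?_ (inv_pos.2 (hδ n)).le
    refine intervalIntegral.integral_mono_on (hδ n).le (hgc _ _ _) (hgc _ _ _) fun x _ => hg ?_
    have := hφmono n hst
    gcongr
  · intro n
    have h1 := hlow n (-T)
    have h2 := hupp n (-T)
    rw [hφl] at h1 h2
    rw [hl _ (by linarith [hδ n])] at h1 h2
    simp only [hφl]
    exact le_antisymm h2 h1
  · intro n
    have h1 := hlow n T
    have h2 := hupp n T
    rw [hφr] at h1 h2
    rw [hr _ (by linarith [hδ n])] at h1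
    rw [hr _ le_rfl] at h2
    simp only [hφr]
    exact le_antisymm h2 h1
  · intro t ht
    refine tendsto_of_tendsto_of_tendsto_of_le_of_le (g := fun n => g (φ n t + δ n))
      (h := fun n => g (φ n t)) (ht.tendsto.comp ?_) (ht.tendsto.comp (hφlim t))
      (fun n => hlow n t) (fun n => hupp n t)
    simpa using (hφlim t).add hδlim

lemma exists_mem_Ioo_or_eq_of_partition {P : ℕ → ℝ} {t : ℝ} (h0 : P 0 < t) :
    ∀ m, t < P m → (∃ i < m, t ∈ Ioo (P i) (P (i + 1))) ∨ ∃ i, t = P i := by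
  intro m
  induction m with
  | zero => intro h; exact absurd h h0.not_gt
  | succ m ih =>
    intro h
    rcases lt_trichotomy t (P m) with h' | h' | h'
    · rcases ih h' with ⟨i, hi, hti⟩ | h''
      · exact Or.inl ⟨i, by omega, hti⟩
      · exact Or.inr h''
    · exact Or.inr ⟨m, h'⟩
    · exact Or.inl ⟨m, by omega, h', h⟩

/-- A function that decreases on the pieces of a partition and jumps down at its nodes is
antitone off the nodes. -/
lemma antitone_of_partition {P : ℕ → ℝ} {m : ℕ} {g : ℝ → ℝ}
    (hP : ∀ i < m, P i < P (i + 1))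
    (hpiece : ∀ i < m, AntitoneOn g (Ioo (P i) (P (i + 1))))
    (hjump : ∀ i, 0 < i → i < m → ∃ lm lp, Tendsto g (𝓝[<] (P i)) (𝓝 lm) ∧
      Tendsto g (𝓝[>] (P i)) (𝓝 lp) ∧ lp ≤ lm)
    {i : ℕ} {s : ℝ} (hs : s ∈ Ioo (P i) (P (i + 1))) :
    ∀ j, i ≤ j → j < m → ∀ t ∈ Ioo (P j) (P (j + 1)), s ≤ t → g t ≤ g s := by
  intro j hij
  induction j, hij using Nat.le_induction with
  | base => intro hj t ht hst; exact hpiece i hj hs ht hst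
  | succ j hij ih =>
    intro hj t ht _
    have hjm : j < m := by omega
    obtain ⟨lm, lp, h1, h2, h3⟩ := hjump (j + 1) (by omega) hj
    have hsj : s < P (j + 1) := by
      have hmono : ∀ k, i ≤ k → k ≤ j → P (i + 1) ≤ P (k + 1) := by
        intro k hik
        induction k, hik using Nat.le_induction with
        | base => intro _; exact le_rfl
        | succ k hik ihk => intro hk; exact (ihk (by omega)).trans (hP (k + 1) (by omega)).le
      exact hs.2.trans_le (hmono j hij le_rfl)
    have hlm : lm ≤ g s := by
      refine le_of_tendsto h1 ?_
      filter_upwards [Ioo_mem_nhdsLT (max_lt hsj (hP j hjm))] with r hr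
      exact ih hjm r ⟨(le_max_right _ _).trans_lt hr.1, hr.2⟩ ((le_max_left _ _).trans hr.1.le)
    have hlp : g t ≤ lp := by
      refine ge_of_tendsto h2 ?_
      filter_upwards [Ioo_mem_nhdsGT ht.1] with r hr
      exact hpiece (j + 1) hj ⟨hr.1, hr.2.trans ht.2⟩ ht hr.2.le
    linarith

/-- The positive part of the derivative, extended by zero outside `(-T, T)`. -/
def ppartDeriv (T : ℝ) (u' : ℝ → ℝ) : ℝ → ℝ := (Ioo (-T) T).indicator fun t => ppart (u' t)

lemma ppartDeriv_of_mem {T t : ℝ} {u' : ℝ → ℝ} (ht : t ∈ Ioo (-T) T) :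
    ppartDeriv T u' t = ppart (u' t) := indicator_of_mem ht _

lemma ppartDeriv_nonneg (T t : ℝ) (u' : ℝ → ℝ) : 0 ≤ ppartDeriv T u' t :=
  indicator_nonneg (fun _ _ => ppart_nonneg _) t

lemma MemWpw.intervalIntegrable {p T : ℝ} {u u' : ℝ → ℝ} (h : MemWpw p T u u') :
    IntervalIntegrable u' volume (-T) T := by
  obtain ⟨m, P, -, h0, hm, -, hI, -⟩ := h
  rw [← h0, ← hm]
  exact IntervalIntegrable.trans_iterate fun i hi => (hI i hi).1

lemma MemWpw.integrableOn_rpow {p T : ℝ} {u u' : ℝ → ℝ} (hT : 0 < T) (h : MemWpw p T u u') :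
    IntegrableOn (fun t => |u' t| ^ p) (Ioo (-T) T) := by
  obtain ⟨m, P, -, h0, hm, hP, hI, -⟩ := h
  rw [← intervalIntegrable_iff_integrableOn_Ioo_of_le (by linarith), ← h0, ← hm]
  refine IntervalIntegrable.trans_iterate fun i hi => ?_
  rw [intervalIntegrable_iff_integrableOn_Ioo_of_le (hP i hi).le]
  exact (hI i hi).2.2

lemma MemWpw.integrable_ppartDeriv {p T : ℝ} {u u' : ℝ → ℝ} (hT : 0 < T)
    (h : MemWpw p T u u') : Integrable (ppartDeriv T u') := by
  have h1 : IntegrableOn u' (Ioo (-T) T) :=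
    (intervalIntegrable_iff_integrableOn_Ioo_of_le (by linarith)).1 h.intervalIntegrable
  exact (integrable_indicator_iff measurableSet_Ioo).2 h1.pos_part

/-- Subtracting the primitive of the positive part of the derivative from an element of
`W_pw^{1,p,+}` leaves a nonincreasing function. -/
lemma MemWpw.exists_antitone {p T : ℝ} {u u' : ℝ → ℝ} (hT : 0 < T) (h : MemWpw p T u u') :
    ∃ g : ℝ → ℝ, Antitone g ∧ (∀ t ≤ -T, g t = 0) ∧
      (∀ t, T ≤ t → g t = -∫ r in (-T)..T, ppartDeriv T u' r) ∧
      ∀ᵐ t, t ∈ Ioo (-T) T → u t = (∫ r in (-T)..t, ppartDeriv T u' r) + g t := by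
  have hWi := h.integrable_ppartDeriv hT
  set W := ppartDeriv T u' with hW
  have hW0 : ∀ t, 0 ≤ W t := fun t => ppartDeriv_nonneg T t u'
  have hWab : ∀ a b, IntervalIntegrable W volume a b := fun a b => hWi.intervalIntegrable
  set F : ℝ → ℝ := fun t => ∫ r in (-T)..t, W r with hF
  have hFc : Continuous F := intervalIntegral.continuous_primitive hWab _
  have hFsub : ∀ s t, F t - F s = ∫ r in s..t, W r := fun s t =>
    intervalIntegral.integral_interval_sub_left (hWab _ _) (hWab _ _)
  have hF0 : F (-T) = 0 := intervalIntegral.integral_same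
  have hM : 0 ≤ F T := intervalIntegral.integral_nonneg (by linarith) fun t _ => hW0 t
  obtain ⟨m, P, hm0, h0, hm, hP, hI, ⟨l₀, hl₀, hl₀'⟩, ⟨l₁, hl₁, hl₁'⟩, hJ⟩ := h
  have hPmono : ∀ i j, i ≤ j → j ≤ m → P i ≤ P j := by
    intro i j hij
    induction j, hij using Nat.le_induction with
    | base => intro _; exact le_rfl
    | succ k hik ihk => intro hk; exact (ihk (by omega)).trans (hP k (by omega)).le
  have hsub : ∀ i < m, Ioo (P i) (P (i + 1)) ⊆ Ioo (-T) T := by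
    intro i hi
    refine Ioo_subset_Ioo ?_ ?_
    · rw [← h0]; exact hPmono 0 i (by omega) hi.le
    · rw [← hm]; exact hPmono (i + 1) m (by omega) le_rfl
  set g₀ : ℝ → ℝ := fun t => u t - F t with hg₀
  have hpiece : ∀ i < m, AntitoneOn g₀ (Ioo (P i) (P (i + 1))) := by
    intro i hi s hs t ht hst
    have hle : ∫ r in s..t, u' r ≤ ∫ r in s..t, W r := by
      refine intervalIntegral.integral_mono_on hst ?_ (hWab _ _) fun r hr => ?_
      · refine (hI i hi).1.mono_set (uIcc_subset_uIcc ?_ ?_) <;> rw [uIcc_of_le (hP i hi).le]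
        exacts [Ioo_subset_Icc_self hs, Ioo_subset_Icc_self ht]
      · have hr' : r ∈ Ioo (P i) (P (i + 1)) := ⟨hs.1.trans_le hr.1, hr.2.trans_lt ht.2⟩
        rw [hW, ppartDeriv_of_mem (hsub i hi hr')]
        exact le_ppart _
    have h1 := (hI i hi).2.1 s hs t ht
    have h2 := hFsub s t
    simp only [hg₀]
    linarith
  have hjump : ∀ i, 0 < i → i < m → ∃ lm lp, Tendsto g₀ (𝓝[<] (P i)) (𝓝 lm) ∧
      Tendsto g₀ (𝓝[>] (P i)) (𝓝 lp) ∧ lp ≤ lm := by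
    intro i hi0 hi
    obtain ⟨lm, lp, h1, h2, h3⟩ := hJ i hi0 hi
    exact ⟨lm - F (P i), lp - F (P i), h1.sub (hFc.continuousWithinAt),
      h2.sub (hFc.continuousWithinAt), by linarith⟩
  have hanti : ∀ i < m, ∀ s ∈ Ioo (P i) (P (i + 1)), ∀ j < m, ∀ t ∈ Ioo (P j) (P (j + 1)),
      s ≤ t → g₀ t ≤ g₀ s := by
    intro i hi s hs j hj t ht hst
    rcases le_or_gt i j with hij | hij
    · exact antitone_of_partition hP hpiece hjump hs j hij hj t ht hst
    · have := hPmono (j + 1) i hij hi.le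
      linarith [hs.1, ht.2]
  have hup : ∀ j < m, ∀ t ∈ Ioo (P j) (P (j + 1)), g₀ t ≤ 0 := by
    intro j hj t ht
    have hlim : Tendsto g₀ (𝓝[>] (-T)) (𝓝 (l₀ - F (-T))) := hl₀.sub hFc.continuousWithinAt
    have hP1 : -T < P 1 := by rw [← h0]; exact hP 0 hm0
    have : g₀ t ≤ l₀ - F (-T) := by
      refine ge_of_tendsto hlim ?_
      filter_upwards [Ioo_mem_nhdsGT (lt_min hP1 (hsub j hj ht).1)] with r hr
      refine hanti 0 hm0 r ⟨?_, hr.2.trans_le (min_le_left _ _)⟩ j hj t ht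
        (hr.2.le.trans (min_le_right _ _))
      rw [h0]; exact hr.1
    linarith
  have hdown : ∀ j < m, ∀ t ∈ Ioo (P j) (P (j + 1)), -F T ≤ g₀ t := by
    intro j hj t ht
    have hlim : Tendsto g₀ (𝓝[<] T) (𝓝 (l₁ - F T)) := hl₁.sub hFc.continuousWithinAt
    have hm1 : m - 1 + 1 = m := by omega
    have hP1 : P (m - 1) < T := by
      have := hP (m - 1) (by omega)
      rwa [hm1, hm] at this
    have : l₁ - F T ≤ g₀ t := by
      refine le_of_tendsto hlim ?_
      filter_upwards [Ioo_mem_nhdsLT (max_lt hP1 (hsub j hj ht).2)] with r hr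
      refine hanti j hj t ht (m - 1) (by omega) r ⟨(le_max_left _ _).trans_lt hr.1, ?_⟩
        ((le_max_right _ _).trans hr.1.le)
      rw [hm1, hm]; exact hr.2
    linarith
  set g₁ : ℝ → ℝ := fun t => if t ≤ -T then 0 else if T ≤ t then -F T else g₀ t with hg₁
  set S : Set ℝ := {t | t ≤ -T ∨ T ≤ t ∨ ∃ i < m, t ∈ Ioo (P i) (P (i + 1))} with hS
  have hval1 : ∀ t ≤ -T, g₁ t = 0 := fun t ht => by simp [hg₁, ht]
  have hval2 : ∀ t, T ≤ t → g₁ t = -F T := fun t ht => by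
    have : ¬ t ≤ -T := by linarith
    simp [hg₁, ht, this]
  have hval3 : ∀ i < m, ∀ t ∈ Ioo (P i) (P (i + 1)), g₁ t = g₀ t := fun i hi t ht => by
    have := hsub i hi ht
    simp [hg₁, this.1.not_ge, this.2.not_ge]
  have hbd : ∀ t ∈ S, -F T ≤ g₁ t ∧ g₁ t ≤ 0 := by
    rintro t (ht | ht | ⟨i, hi, ht⟩)
    · rw [hval1 t ht]; exact ⟨by linarith, le_rfl⟩
    · rw [hval2 t ht]; exact ⟨le_rfl, by linarith⟩
    · rw [hval3 i hi t ht]; exact ⟨hdown i hi t ht, hup i hi t ht⟩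
  have hg₁anti : AntitoneOn g₁ S := by
    intro s hs t ht hst
    rcases id hs with hs' | hs' | ⟨i, hi, hs'⟩
    · rw [hval1 s hs']; exact (hbd t ht).2
    · rw [hval2 s hs', hval2 t (hs'.trans hst)]
    · rcases id ht with ht' | ht' | ⟨j, hj, ht'⟩
      · linarith [(hsub i hi hs').1]
      · rw [hval2 t ht']; exact (hbd s hs).1
      · rw [hval3 i hi s hs', hval3 j hj t ht']
        exact hanti i hi s hs' j hj t ht' hst
  obtain ⟨g, hganti, hgeq⟩ := hg₁anti.exists_antitone_extension
    ⟨-F T, by rintro _ ⟨t, ht, rfl⟩; exact (hbd t ht).1⟩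
    ⟨0, by rintro _ ⟨t, ht, rfl⟩; exact (hbd t ht).2⟩
  refine ⟨g, hganti, fun t ht => ?_, fun t ht => ?_, ?_⟩
  · rw [← hgeq (Or.inl ht), hval1 t ht]
  · rw [← hgeq (Or.inr (Or.inl ht)), hval2 t ht]
  · have hnull : ∀ᵐ t, t ∉ range P := (countable_range P).ae_notMem _
    filter_upwards [hnull] with t ht htT
    rcases exists_mem_Ioo_or_eq_of_partition (P := P) (t := t) (by rw [h0]; exact htT.1) m
      (by rw [hm]; exact htT.2) with ⟨i, hi, hti⟩ | ⟨i, hi⟩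
    · rw [← hgeq (Or.inr (Or.inr ⟨i, hi, hti⟩)), hval3 i hi t hti]
      simp [hg₀, hF]
    · exact absurd ⟨i, hi.symm⟩ ht

/-- Adding a Lipschitz nonincreasing function that compensates the boundary values of the
primitive of `ppart u'` gives an element of `W^{1,p}_0`. -/
lemma memW1p0_primitive_add {p T : ℝ} {W G : ℝ → ℝ} {K : NNReal} (hp : 1 ≤ p)
    (hWi : Integrable W) (hWp : IntegrableOn (fun t => |W t| ^ p) (Ioo (-T) T))
    (hG : LipschitzWith K G) (hGl : G (-T) = 0) (hGr : G T = -∫ r in (-T)..T, W r) :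
    MemW1p0 p (-T) T (fun t => (∫ r in (-T)..t, W r) + G t) (fun t => W t + deriv G t) := by
  have hac : ∀ a b, AbsolutelyContinuousOnInterval G a b := fun a b =>
    (hG.lipschitzOnWith (s := uIcc a b)).absolutelyContinuousOnInterval
  have hdi : ∀ a b, IntervalIntegrable (deriv G) volume a b := fun a b =>
    (hac a b).intervalIntegrable_deriv
  refine ⟨⟨hWi.intervalIntegrable.add (hdi _ _), fun t _ => ?_, ?_⟩, ?_, ?_⟩
  · rw [intervalIntegral.integral_add hWi.intervalIntegrable (hdi _ _),
      (hac _ _).integral_deriv_eq_sub]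
    simp [hGl]
  · have hp0 : ENNReal.ofReal p ≠ 0 := by
      simp only [ne_eq, ENNReal.ofReal_eq_zero, not_le]; linarith
    have hpt : (ENNReal.ofReal p).toReal = p := ENNReal.toReal_ofReal (by linarith)
    have h1 : MemLp W (ENNReal.ofReal p) (volume.restrict (Ioo (-T) T)) := by
      rw [← integrable_norm_rpow_iff hWi.aestronglyMeasurable.restrict hp0 ENNReal.ofReal_ne_top,
        hpt]
      exact hWp
    have h2 : MemLp (deriv G) (ENNReal.ofReal p) (volume.restrict (Ioo (-T) T)) :=
      MemLp.of_bound (measurable_deriv G).aestronglyMeasurable K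
        (ae_of_all _ fun t => norm_deriv_le_of_lipschitz hG)
    have h3 := (h1.add h2).integrable_norm_rpow hp0 ENNReal.ofReal_ne_top
    rw [hpt] at h3
    exact h3
  · simp [hGl]
  · simp [hGr]

lemma MemWpw.lamPlus_le {p T : ℝ} {u u' : ℝ → ℝ} (hp : 1 < p) (hT : 0 < T)
    (h : MemWpw p T u u') (hu : (∫ t in Ioo (-T) T, |u t| ^ p) = 1) :
    lamPlus p T ≤ ∫ t in Ioo (-T) T, ppart (u' t) ^ p := by
  have hp0 : 0 < p := by linarith
  obtain ⟨g, hg, hgl, hgr, hug⟩ := h.exists_antitone hT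
  have hWi := h.integrable_ppartDeriv hT
  have hup := h.integrableOn_rpow hT
  have hu'm : AEStronglyMeasurable u' (volume.restrict (Ioo (-T) T)) :=
    ((intervalIntegrable_iff_integrableOn_Ioo_of_le (by linarith)).1
      h.intervalIntegrable).aestronglyMeasurable
  have hpp : IntegrableOn (fun t => ppart (u' t) ^ p) (Ioo (-T) T) := by
    refine hup.mono' ?_ (ae_of_all _ fun t => ?_)
    · exact ((continuous_ppart.rpow_const fun _ => Or.inr hp0.le).comp_aestronglyMeasurable hu'm)
    · rw [Real.norm_of_nonneg (Real.rpow_nonneg (ppart_nonneg _) _)]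
      exact Real.rpow_le_rpow (ppart_nonneg _) (ppart_le_abs _) hp0.le
  set W := ppartDeriv T u' with hW
  have hW0 : ∀ t, 0 ≤ W t := fun t => ppartDeriv_nonneg T t u'
  have hWp : IntegrableOn (fun t => |W t| ^ p) (Ioo (-T) T) := by
    refine hpp.congr_fun (fun t ht => ?_) measurableSet_Ioo
    simp only
    rw [abs_of_nonneg (hW0 t), hW, ppartDeriv_of_mem ht]
  set F : ℝ → ℝ := fun t => ∫ r in (-T)..t, W r with hF
  have hWab : ∀ a b, IntervalIntegrable W volume a b := fun a b => hWi.intervalIntegrable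
  have hFc : Continuous F := intervalIntegral.continuous_primitive hWab _
  have hFb : ∀ t ∈ Ioo (-T) T, 0 ≤ F t ∧ F t ≤ F T := fun t ht =>
    ⟨intervalIntegral.integral_nonneg ht.1.le fun r _ => hW0 r,
      intervalIntegral.integral_mono_interval le_rfl ht.1.le ht.2.le (ae_of_all _ hW0)
        (hWab _ _)⟩
  obtain ⟨G, hGL, hGa, hGl, hGr, hGlim⟩ := hg.exists_lipschitz_approx hT hgl hgr
  choose K hK using hGL
  have hmem : ∀ n, MemW1p0 p (-T) T (fun t => F t + G n t) (fun t => W t + deriv (G n) t) :=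
    fun n => memW1p0_primitive_add hp.le hWi hWp (hK n) (hGl n) (hGr n)
  have henergy : ∀ n, ∫ t in Ioo (-T) T, ppart (W t + deriv (G n) t) ^ p ≤
      ∫ t in Ioo (-T) T, ppart (u' t) ^ p := by
    intro n
    refine integral_mono_of_nonneg (ae_of_all _ fun t => Real.rpow_nonneg (ppart_nonneg _) _) hpp ?_
    refine (ae_restrict_iff' measurableSet_Ioo).2 (ae_of_all _ fun t ht => ?_)
    refine Real.rpow_le_rpow (ppart_nonneg _) (max_le ?_ (ppart_nonneg _)) hp0.le
    have h1 : deriv (G n) t ≤ 0 := (hGa n).deriv_nonpos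
    have h2 : W t = ppart (u' t) := ppartDeriv_of_mem ht
    linarith
  have hlim : Tendsto (fun n => ∫ t in Ioo (-T) T, |F t + G n t| ^ p) atTop (𝓝 1) := by
    rw [← hu]
    refine tendsto_integral_of_dominated_convergence (fun _ => |F T| ^ p) (fun n => ?_) ?_
      (fun n => ?_) ?_
    · have : Continuous fun t => |F t + G n t| := (hFc.add (hK n).continuous).abs
      exact (this.rpow_const fun _ => Or.inr hp0.le).aestronglyMeasurable
    · simp
    · refine (ae_restrict_iff' measurableSet_Ioo).2 (ae_of_all _ fun t ht => ?_)
      rw [Real.norm_of_nonneg (Real.rpow_nonneg (abs_nonneg _) _)]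
      refine Real.rpow_le_rpow (abs_nonneg _) ?_ hp0.le
      have h1 : G n t ≤ 0 := (hGl n) ▸ hGa n ht.1.le
      have h2 : -F T ≤ G n t := (hGr n) ▸ hGa n ht.2.le
      have h3 := hFb t ht
      exact (abs_le.2 ⟨by linarith, by linarith⟩).trans (le_abs_self _)
    · have hcount : ∀ᵐ t, t ∉ {t | ¬ContinuousAt g t} :=
        hg.countable_not_continuousAt.ae_notMem _
      refine (ae_restrict_iff' measurableSet_Ioo).2 ?_
      filter_upwards [hug, hcount] with t h1 h2 ht
      rw [h1 ht]
      refine Tendsto.rpow_const ?_ (Or.inr hp0.le)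
      exact ((hGlim t (not_not.1 h2)).const_add (F t)).abs
  have hlim' : Tendsto (fun n => (∫ t in Ioo (-T) T, |F t + G n t| ^ p)⁻¹ *
      ∫ t in Ioo (-T) T, ppart (u' t) ^ p) atTop (𝓝 (∫ t in Ioo (-T) T, ppart (u' t) ^ p)) := by
    simpa using (hlim.inv₀ one_ne_zero).mul_const (∫ t in Ioo (-T) T, ppart (u' t) ^ p)
  refine ge_of_tendsto hlim' ?_
  filter_upwards [hlim.eventually (lt_mem_nhds one_pos)] with n hn
  exact (lamPlus_le_inv_mul hp0 (hmem n) hn).trans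
    (mul_le_mul_of_nonneg_left (henergy n) (inv_pos.2 hn).le)

theorem lamPlus_pw (p T : ℝ) (hp : 1 < p) (hT : 0 < T) :
    lamPlus p T = sInf { E | ∃ u u', MemWpw p T u u' ∧
      (∫ t in Set.Ioo (-T) T, |u t| ^ p) = 1 ∧
      E = ∫ t in Set.Ioo (-T) T, ppart (u' t) ^ p } := by
  obtain ⟨u₀, u₀', hu₀, hn₀⟩ := exists_memW1p0_normalized (p := p) (by linarith) hT
  apply le_antisymm
  · refine le_csInf ⟨_, u₀, u₀', hu₀.memWpw hT, hn₀, rfl⟩ ?_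
    rintro E ⟨u, u', hu, hn, rfl⟩
    exact hu.lamPlus_le hp hT hn
  · refine csInf_le_csInf ⟨0, ?_⟩ ⟨_, u₀, u₀', hu₀, hn₀, rfl⟩ ?_
    · rintro E ⟨u, u', -, -, rfl⟩
      exact integral_ppart_rpow_nonneg p u' _
    · rintro E ⟨u, u', hu, hn, rfl⟩
      exact ⟨u, u', hu.memWpw hT, hn, rfl⟩

end
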